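/- arXiv:2209.08134 — 4 statements merged into one kernel-verified Lean document; each statement's English description precedes it below -/
import Mathlib

section
/- For every n and every coloured graph G on n vertices, the number of cherries of G satisfies c(G) ≤ f(n). -/
/-- `f 0 = f 1 = 0` and, for `n ≥ 2`,
`f n = max over 1 ≤ k ≤ n − 1 of (k choose 2)·(n − k) + f (n − k)`
(here `k = j + 1` ranges over `1, …, n − 1`). -/
def f : ℕ → ℕ
  | 0 => 0
  | 1 => 0
  | n + 2 =>
    (Finset.range (n + 1)).sup fun j =>
      Nat.choose (j + 1) 2 * (n + 1 - j) + f (n + 1 - j)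
  decreasing_by omega
/-- A coloured graph on `V`: every pair of distinct vertices is either blue, or red with
an orientation (`Red x y` means red, directed from `x` to `y`). -/
structure ColouredGraph (V : Type) where
  Blue : V → V → Prop
  Red : V → V → Prop
  blue_symm : ∀ x y, Blue x y → Blue y x
  trichotomy : ∀ x y : V, x ≠ y →
    (Blue x y ∧ ¬ Red x y ∧ ¬ Red y x) ∨
    (¬ Blue x y ∧ Red x y ∧ ¬ Red y x) ∨
    (¬ Blue x y ∧ ¬ Red x y ∧ Red y x)

/-- A cherry of `G`: a 3-element set `{x, y, z}` with `Red x y`, `Red x z` and `Blue y z`. -/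
def IsCherry {V : Type} [DecidableEq V] (G : ColouredGraph V) (e : Finset V) : Prop :=
  ∃ x y z : V, x ≠ y ∧ x ≠ z ∧ y ≠ z ∧ e = ({x, y, z} : Finset V) ∧
    G.Red x y ∧ G.Red x z ∧ G.Blue y z

/-- `c(G)`, the number of cherries of `G`. -/
noncomputable def cherryCount {V : Type} [DecidableEq V] (G : ColouredGraph V) : ℕ :=
  Set.ncard {e : Finset V | IsCherry G e}

section Aux

open Classical

/-- Ordered cherries. -/
def OCh {V : Type} (G : ColouredGraph V) (p : V × V × V) : Prop :=
  p.1 ≠ p.2.1 ∧ p.1 ≠ p.2.2 ∧ p.2.1 ≠ p.2.2 ∧ G.Red p.1 p.2.1 ∧ G.Red p.1 p.2.2 ∧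
    G.Blue p.2.1 p.2.2

/-- The finset of ordered cherries. -/
noncomputable def trip {V : Type} [Fintype V] (G : ColouredGraph V) : Finset (V × V × V) :=
  Finset.univ.filter (OCh G)

/-- The triple contains the vertex. -/
def Has {V : Type} (x : V) (p : V × V × V) : Prop := p.1 = x ∨ p.2.1 = x ∨ p.2.2 = x

/-- Pullback of a coloured graph. -/
def pull {V : Type} (G : ColouredGraph V) (s : V → V) : ColouredGraph V where
  Blue u v := s u = s v ∨ G.Blue (s u) (s v)
  Red u v := s u ≠ s v ∧ G.Red (s u) (s v)
  blue_symm := by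
    intro u v h
    rcases h with h | h
    · exact Or.inl h.symm
    · exact Or.inr (G.blue_symm _ _ h)
  trichotomy := by
    intro u v _
    by_cases h : s u = s v
    · left; simp [h]
    · have h2 : s v ≠ s u := fun e => h e.symm
      have := G.trichotomy _ _ h
      simp only [h, h2, false_or, ne_eq, not_false_eq_true, true_and]
      exact this

lemma two_mul_cherry {n : ℕ} (G : ColouredGraph (Fin n)) :
    2 * cherryCount G ≤ (trip G).card := by
  have hfin : {e : Finset (Fin n) | IsCherry G e}.Finite := Set.toFinite _
  unfold cherryCount
  rw [Set.ncard_eq_toFinset_card _ hfin, mul_comm]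
  have key : ∀ e ∈ hfin.toFinset,
      2 ≤ ((trip G).filter (fun p => ({p.1, p.2.1, p.2.2} : Finset (Fin n)) = e)).card := by
    intro e he
    simp only [Set.Finite.mem_toFinset, Set.mem_ofPred_eq] at he
    obtain ⟨x, y, z, hxy, hxz, hyz, rfl, r1, r2, b⟩ := he
    have hne : ((x, y, z) : Fin n × Fin n × Fin n) ≠ (x, z, y) := by
      simp [hyz]
    rw [← Finset.card_pair hne]
    apply Finset.card_le_card
    intro p hp
    simp only [Finset.mem_insert, Finset.mem_singleton] at hp
    rcases hp with rfl | rfl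
    · simp [trip, OCh, *]
    · simp only [trip, OCh, Finset.mem_filter, Finset.mem_univ, true_and]
      refine ⟨⟨hxz, hxy, hyz.symm, r2, r1, G.blue_symm _ _ b⟩, ?_⟩
      ext t; simp; tauto
  calc hfin.toFinset.card * 2 = ∑ e ∈ hfin.toFinset, 2 := by simp
    _ ≤ ∑ e ∈ hfin.toFinset,
      ((trip G).filter (fun p => ({p.1, p.2.1, p.2.2} : Finset (Fin n)) = e)).card :=
        Finset.sum_le_sum key
    _ ≤ (trip G).card := by
        rw [← Finset.card_biUnion]
        · apply Finset.card_le_card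
          intro p hp
          simp only [Finset.mem_biUnion, Finset.mem_filter] at hp
          obtain ⟨_, _, h, _⟩ := hp
          exact h
        · intro a _ b _ hab
          rw [Function.onFun, Finset.disjoint_left]
          intro p h1 h2
          simp only [Finset.mem_filter] at h1 h2
          exact hab (h1.2.symm.trans h2.2)

/-- Ordered cherries avoiding `x` and `y`. -/
noncomputable def n0 {V : Type} [Fintype V] (G : ColouredGraph V) (x y : V) : ℕ :=
  (Finset.univ.filter (fun p => OCh G p ∧ ¬ Has x p ∧ ¬ Has y p)).card

/-- Ordered cherries containing `x` but not `y`. -/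
noncomputable def n1 {V : Type} [Fintype V] (G : ColouredGraph V) (x y : V) : ℕ :=
  (Finset.univ.filter (fun p => OCh G p ∧ Has x p ∧ ¬ Has y p)).card

/-- Common in-neighbours. -/
noncomputable def com {V : Type} [Fintype V] (G : ColouredGraph V) (x y : V) : Finset V :=
  Finset.univ.filter (fun w => w ≠ x ∧ w ≠ y ∧ G.Red w x ∧ G.Red w y)

lemma red_not_blue {V : Type} (G : ColouredGraph V) {x y : V} (h : x ≠ y) (b : G.Blue x y) :
    ¬ G.Red x y ∧ ¬ G.Red y x := by
  have := G.trichotomy x y h; tauto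

lemma decomp {V : Type} [Fintype V] (G : ColouredGraph V) {x y : V} (hxy : x ≠ y)
    (b : G.Blue x y) :
    (trip G).card = n0 G x y + n1 G x y + n1 G y x + 2 * (com G x y).card := by
  have h12 : (Finset.univ.filter (fun p => OCh G p ∧ Has x p ∧ Has y p)).card
      = 2 * (com G x y).card := by
    have e : Finset.univ.filter (fun p => OCh G p ∧ Has x p ∧ Has y p)
      = (com G x y).image (fun w => (w, x, y)) ∪ (com G x y).image (fun w => (w, y, x)) := by
      ext ⟨p, q, r⟩
      have := red_not_blue G hxy b
      have b' := G.blue_symm _ _ b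
      rw [Finset.mem_filter]
      simp only [com, Finset.mem_filter, Finset.mem_univ, true_and, Finset.mem_union,
        Finset.mem_image, Prod.mk.injEq]
      simp only [OCh, Has]
      constructor
      · rintro ⟨⟨h1, h2, h3, h4, h5, h6⟩, h7, h8⟩
        rcases h7 with rfl | rfl | rfl <;> rcases h8 with rfl | rfl | rfl <;>
          simp_all
      · rintro (⟨w, ⟨h1, h2, h3, h4⟩, rfl, rfl, rfl⟩ | ⟨w, ⟨h1, h2, h3, h4⟩, rfl, rfl, rfl⟩)
        · simp_all
        · have := hxy.symm
          simp_all
    rw [e, Finset.card_union_of_disjoint, Finset.card_image_of_injective,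
      Finset.card_image_of_injective]
    · ring
    · intro a c h; simpa using h
    · intro a c h; simpa using h
    · rw [Finset.disjoint_left]
      intro p h1 h2
      simp only [Finset.mem_image] at h1 h2
      obtain ⟨w, _, rfl⟩ := h1
      obtain ⟨w', _, h⟩ := h2
      simp only [Prod.mk.injEq] at h
      exact hxy h.2.1.symm
  rw [← h12]
  unfold trip n0 n1
  rw [← Finset.card_filter_add_card_filter_not (s := Finset.univ.filter (OCh G)) (Has x),
    ← Finset.card_filter_add_card_filter_not
      (s := (Finset.univ.filter (OCh G)).filter (Has x)) (Has y),
    ← Finset.card_filter_add_card_filter_not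
      (s := (Finset.univ.filter (OCh G)).filter (fun p => ¬ Has x p)) (Has y)]
  simp only [Finset.filter_filter, and_assoc]
  have : (Finset.univ.filter (fun p => OCh G p ∧ Has y p ∧ ¬ Has x p)) =
    (Finset.univ.filter (fun p => OCh G p ∧ ¬ Has x p ∧ Has y p)) := by
    apply Finset.filter_congr; intros; tauto
  rw [this]
  omega

/-- Redirect `y` to `x`. -/
noncomputable def sg {V : Type} (x y : V) : V → V := fun u => if u = y then x else u

lemma clone {V : Type} [Fintype V] (G : ColouredGraph V) {x y : V} (hxy : x ≠ y) :
    (trip (pull G (sg x y))).card = n0 G x y + 2 * n1 G x y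
      + 2 * (Finset.univ.filter (fun w => w ≠ x ∧ w ≠ y ∧ G.Red w x)).card := by
  have sy : sg x y y = x := by simp [sg]
  have sx : sg x y x = x := by simp [sg]
  have so : ∀ u, u ≠ y → sg x y u = u := by intro u h; simp [sg, h]
  rw [decomp _ hxy (Or.inl (by rw [sx, sy]))]
  have base : ∀ p, ¬ Has y p → (OCh (pull G (sg x y)) p ↔ OCh G p) := by
    rintro ⟨a, b, c⟩ h
    simp only [Has, not_or] at h
    simp only [OCh, pull, so a h.1, so b h.2.1, so c h.2.2]
    tauto
  have e0 : n0 (pull G (sg x y)) x y = n0 G x y := by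
    unfold n0
    congr 1
    apply Finset.filter_congr
    intro p _
    have := base p
    tauto
  have e1 : n1 (pull G (sg x y)) x y = n1 G x y := by
    unfold n1
    congr 1
    apply Finset.filter_congr
    intro p _
    have := base p
    tauto
  have e2 : n1 (pull G (sg x y)) y x = n1 G x y := by
    unfold n1
    let w := Equiv.swap x y
    have wne : ∀ u v : V, w u = w v ↔ u = v := fun u v => w.injective.eq_iff
    have wx : ∀ u, w u = y ↔ u = x := by
      intro u; rw [← wne u x]; simp [w]
    have wy : ∀ u, w u = x ↔ u = y := by
      intro u; rw [← wne u y]; simp [w]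
    have ws : ∀ u, u ≠ x → w u = sg x y u := by
      intro u hu
      by_cases h : u = y
      · subst h; simp [w, sg]
      · rw [so u h]; exact Equiv.swap_apply_of_ne_of_ne hu h
    apply Finset.card_equiv (w.prodCongr (w.prodCongr w))
    rintro ⟨a, b, c⟩
    simp only [Finset.mem_filter, Finset.mem_univ, true_and, Equiv.prodCongr_apply, Prod.map,
      Has, OCh, wx, wy, not_or, pull, wne, ne_eq]
    constructor
    · rintro ⟨⟨h1, h2, h3, h4, h5, h6⟩, h7, h8, h9, h10⟩
      rw [← ws a h8, ← ws b h9] at h4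
      rw [← ws a h8, ← ws c h10] at h5
      rw [← ws b h9, ← ws c h10, wne] at h6
      simp_all
    · rintro ⟨⟨h1, h2, h3, h4, h5, h6⟩, h7, h8, h9, h10⟩
      rw [← ws a h8, ← ws b h9, ← ws c h10, wne, wne, wne]
      simp_all
  have e3 : com (pull G (sg x y)) x y
      = Finset.univ.filter (fun w => w ≠ x ∧ w ≠ y ∧ G.Red w x) := by
    unfold com
    apply Finset.filter_congr
    intro w _
    simp only [pull, sx, sy]
    constructor
    · rintro ⟨h1, h2, ⟨h3, h4⟩, _⟩
      rw [so w h2] at h4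
      exact ⟨h1, h2, h4⟩
    · rintro ⟨h1, h2, h3⟩
      rw [so w h2]
      exact ⟨h1, h2, ⟨h1, h3⟩, ⟨h1, h3⟩⟩
  rw [e0, e1, e2, e3]
  ring

lemma n0_comm {V : Type} [Fintype V] (G : ColouredGraph V) (x y : V) : n0 G x y = n0 G y x := by
  unfold n0
  congr 1
  apply Finset.filter_congr
  intros; tauto

lemma extremal {V : Type} [Fintype V] (G : ColouredGraph V)
    (hG : ∀ G' : ColouredGraph V, (trip G').card ≤ (trip G).card)
    (x y : V) (hxy : x ≠ y) (b : G.Blue x y) (w : V) (hwx : w ≠ x) (hwy : w ≠ y)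
    (hr : G.Red w x) : G.Red w y := by
  by_contra hn
  have h1 := hG (pull G (sg x y))
  have h2 := hG (pull G (sg y x))
  rw [clone G hxy, decomp G hxy b] at h1
  rw [clone G hxy.symm, decomp G hxy b, n0_comm G y x] at h2
  have h3 : (com G x y).card <
      (Finset.univ.filter (fun w => w ≠ x ∧ w ≠ y ∧ G.Red w x)).card := by
    apply Finset.card_lt_card
    rw [Finset.ssubset_iff_of_subset]
    · exact ⟨w, by simp [hwx, hwy, hr], by simp [com, hn]⟩
    · intro u; simp only [com, Finset.mem_filter]; tauto
  have h4 : (com G x y).card ≤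
      (Finset.univ.filter (fun w => w ≠ y ∧ w ≠ x ∧ G.Red w y)).card := by
    apply Finset.card_le_card
    intro u; simp only [com, Finset.mem_filter]; tauto
  omega

lemma f_step (n k : ℕ) (h1 : 1 ≤ k) (h2 : k < n) :
    Nat.choose k 2 * (n - k) + f (n - k) ≤ f n := by
  obtain ⟨m, rfl⟩ : ∃ m, n = m + 2 := ⟨n - 2, by omega⟩
  obtain ⟨j, rfl⟩ : ∃ j, k = j + 1 := ⟨k - 1, by omega⟩
  rw [f]
  have e : m + 2 - (j + 1) = m + 1 - j := by omega
  rw [e]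
  exact Finset.le_sup (f := fun j => Nat.choose (j + 1) 2 * (m + 1 - j) + f (m + 1 - j))
    (Finset.mem_range.2 (by omega))

lemma main_bound {V : Type} [Fintype V] (G : ColouredGraph V)
    (hG : ∀ x y : V, x ≠ y → G.Blue x y → ∀ w, w ≠ x → w ≠ y → G.Red w x → G.Red w y) :
    ∀ (n : ℕ) (S : Finset V), S.card = n →
      ((trip G).filter (fun p => p.1 ∈ S ∧ p.2.1 ∈ S ∧ p.2.2 ∈ S)).card ≤ 2 * f n := by
  -- the equivalence relation
  let E : V → V → Prop := fun x y => x = y ∨ G.Blue x y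
  have Esymm : ∀ x y, E x y → E y x := by
    rintro x y (h | h)
    · exact Or.inl h.symm
    · exact Or.inr (G.blue_symm _ _ h)
  have Enr : ∀ x y, x ≠ y → E x y → ¬ G.Red x y := by
    rintro x y h (h' | h')
    · exact absurd h' h
    · exact (red_not_blue G h h').1
  have Etrans : ∀ x y z, E x y → E y z → E x z := by
    intro x y z h1 h2
    by_cases hxy : x = y
    · rw [hxy]; exact h2
    by_cases hyz : y = z
    · rw [← hyz]; exact h1
    by_cases hxz : x = z
    · exact Or.inl hxz
    have b1 : G.Blue x y := h1.resolve_left hxy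
    have b2 : G.Blue y z := h2.resolve_left hyz
    have n1 := red_not_blue G hxy b1
    have n2 := red_not_blue G hyz b2
    rcases G.trichotomy x z hxz with h | h | h
    · exact Or.inr h.1
    · exact absurd (hG z y (Ne.symm hyz) (G.blue_symm _ _ b2) x hxz hxy h.2.1) n1.1
    · exact absurd (hG x y hxy b1 z (Ne.symm hxz) (Ne.symm hyz) h.2.2) n2.2
  have Ered : ∀ w x y, ¬ E w y → w ≠ x → E x y → G.Red w x → G.Red w y := by
    intro w x y h1 h2 h3 h4
    rcases h3 with rfl | h3
    · exact h4
    · by_cases hxy : x = y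
      · rw [← hxy]; exact h4
      · exact hG x y hxy h3 w h2 (fun e => h1 (Or.inl e)) h4
  intro n
  induction n using Nat.strong_induction_on with
  | _ n ih =>
  intro S hS
  rcases S.eq_empty_or_nonempty with rfl | hne
  · simp
  let cls : V → Finset V := fun x => S.filter (E x)
  obtain ⟨x, hx, hmax⟩ := Finset.exists_max_image S (fun x => (cls x).card) hne
  set A := cls x with hA
  have memA : ∀ u, u ∈ A ↔ u ∈ S ∧ E x u := by intro u; simp [hA, cls]
  have hAS : A ⊆ S := Finset.filter_subset _ _
  have hxA : x ∈ A := (memA x).2 ⟨hx, Or.inl rfl⟩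
  have hk1 : 1 ≤ A.card := Finset.card_pos.2 ⟨x, hxA⟩
  by_cases hAeq : A = S
  · have : (trip G).filter (fun p => p.1 ∈ S ∧ p.2.1 ∈ S ∧ p.2.2 ∈ S) = ∅ := by
      apply Finset.filter_eq_empty_iff.2
      rintro ⟨a, b, c⟩ hp ⟨h1, h2, h3⟩
      simp only [trip, OCh, Finset.mem_filter] at hp
      rw [← hAeq] at h1 h2
      exact Enr a b hp.2.1 (Etrans _ _ _ (Esymm _ _ ((memA a).1 h1).2) ((memA b).1 h2).2)
        hp.2.2.2.2.1
    rw [this]; simp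
  have hklt : A.card < n := by
    rw [← hS]; exact Finset.card_lt_card (hAS.ssubset_of_ne hAeq)
  have hcard : (S \ A).card = n - A.card := by
    rw [Finset.card_sdiff_of_subset hAS, hS]
  have hih := ih (n - A.card) (by omega) (S \ A) hcard
  have hf := f_step n A.card hk1 hklt
  set X := (trip G).filter (fun p => p.1 ∈ S ∧ p.2.1 ∈ S ∧ p.2.2 ∈ S) with hX
  set Y := (trip G).filter (fun p => p.1 ∈ S \ A ∧ p.2.1 ∈ S \ A ∧ p.2.2 ∈ S \ A) with hY
  have memX : ∀ a b c, (a, b, c) ∈ X ↔ OCh G (a, b, c) ∧ a ∈ S ∧ b ∈ S ∧ c ∈ S := by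
    intro a b c; simp [hX, trip]
  have memY : ∀ a b c, (a, b, c) ∈ Y ↔ OCh G (a, b, c) ∧ a ∈ S \ A ∧ b ∈ S \ A ∧ c ∈ S \ A := by
    intro a b c; simp [hY, trip]
  have hsplit : X.card ≤ Y.card + (X \ Y).card := by
    have := Finset.card_le_card_sdiff_add_card (s := X) (t := Y)
    omega
  -- structure of the triples meeting A
  have str : ∀ a b c, (a, b, c) ∈ X \ Y → OCh G (a, b, c) ∧ a ∈ S ∧ b ∈ S ∧ c ∈ S ∧
      ((a ∈ A ∧ b ∉ A ∧ c ∉ A) ∨ (a ∉ A ∧ b ∈ A ∧ c ∈ A)) := by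
    intro a b c h
    rw [Finset.mem_sdiff, memX, memY] at h
    obtain ⟨⟨ho, ha, hb, hc⟩, hn⟩ := h
    refine ⟨ho, ha, hb, hc, ?_⟩
    obtain ⟨o1, o2, o3, o4, o5, o6⟩ := id ho
    have bc : b ∈ A ↔ c ∈ A := by
      rw [memA, memA]
      exact ⟨fun h => ⟨hc, Etrans _ _ _ h.2 (Or.inr o6)⟩,
        fun h => ⟨hb, Etrans _ _ _ h.2 (Esymm _ _ (Or.inr o6))⟩⟩
    have ab : a ∈ A → b ∉ A := by
      intro h1 h2
      exact Enr a b o1 (Etrans _ _ _ (Esymm _ _ ((memA a).1 h1).2) ((memA b).1 h2).2) o4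
    simp only [Finset.mem_sdiff] at hn
    tauto
  have hmeet : (X \ Y).card ≤ (A.card * (A.card - 1)) * (S \ A).card := by
    apply Finset.card_le_mul_card_image_of_maps_to
      (f := fun p : V × V × V => if p.1 ∈ A then p.2.1 else p.1)
    · rintro ⟨a, b, c⟩ h
      obtain ⟨-, ha, hb, hc, h⟩ := str a b c h
      by_cases haA : a ∈ A
      · simp only [haA, if_true, Finset.mem_sdiff]; tauto
      · simp only [haA, if_false, Finset.mem_sdiff]; tauto
    · intro w hw
      rw [Finset.mem_sdiff] at hw
      have nE : ∀ u ∈ A, ¬ E w u := by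
        intro u hu h
        exact hw.2 ((memA w).2 ⟨hw.1, Etrans _ _ _ ((memA u).1 hu).2 (Esymm _ _ h)⟩)
      by_cases hr : G.Red w x
      · have hsub : (X \ Y).filter (fun p : V × V × V => (if p.1 ∈ A then p.2.1 else p.1) = w)
            ⊆ A.offDiag.image (fun q => (w, q.1, q.2)) := by
          rintro ⟨a, b, c⟩ h
          rw [Finset.mem_filter] at h
          obtain ⟨h, hw'⟩ := h
          obtain ⟨⟨o1, o2, o3, o4, o5, o6⟩, ha, hb, hc, h⟩ := str a b c h
          rcases h with ⟨h1, h2, h3⟩ | ⟨h1, h2, h3⟩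
          · simp only [h1, if_true] at hw'
            subst hw'
            have r := Ered b x a (nE a h1) (fun e => hw.2 (e ▸ hxA)) ((memA a).1 h1).2 hr
            have := G.trichotomy a b o1
            simp only at o4
            tauto
          · simp only [h1, if_false] at hw'
            subst hw'
            simp only [Finset.mem_image, Finset.mem_offDiag]
            exact ⟨(b, c), ⟨h2, h3, o3⟩, rfl⟩
        calc _ ≤ _ := Finset.card_le_card hsub
          _ ≤ _ := Finset.card_image_le
          _ = _ := by rw [Finset.offDiag_card, Nat.mul_sub_one]
      · have hsub : (X \ Y).filter (fun p : V × V × V => (if p.1 ∈ A then p.2.1 else p.1) = w)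
            ⊆ (A ×ˢ ((cls w).erase w)).image (fun q => (q.1, w, q.2)) := by
          rintro ⟨a, b, c⟩ h
          rw [Finset.mem_filter] at h
          obtain ⟨h, hw'⟩ := h
          obtain ⟨⟨o1, o2, o3, o4, o5, o6⟩, ha, hb, hc, h⟩ := str a b c h
          rcases h with ⟨h1, h2, h3⟩ | ⟨h1, h2, h3⟩
          · simp only [h1, if_true] at hw'
            subst hw'
            simp only [Finset.mem_image, Finset.mem_product, Finset.mem_erase]
            exact ⟨(a, c), ⟨h1, Ne.symm o3, Finset.mem_filter.2 ⟨hc, Or.inr o6⟩⟩, rfl⟩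
          · simp only [h1, if_false] at hw'
            subst hw'
            exact absurd (Ered a b x (nE x hxA) o1 (Esymm _ _ ((memA b).1 h2).2) o4) hr
        calc _ ≤ _ := Finset.card_le_card hsub
          _ ≤ _ := Finset.card_image_le
          _ = A.card * ((cls w).card - 1) := by
            rw [Finset.card_product, Finset.card_erase_of_mem]
            exact Finset.mem_filter.2 ⟨hw.1, Or.inl rfl⟩
          _ ≤ _ := Nat.mul_le_mul_left _ (Nat.sub_le_sub_right (hmax w hw.1) 1)
  rw [hcard] at hmeet
  have hch : A.card * (A.card - 1) = 2 * Nat.choose A.card 2 := by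
    rw [Nat.choose_two_right]
    exact (Nat.two_mul_div_two_of_even (Nat.even_mul_pred_self _)).symm
  rw [hch, mul_assoc] at hmeet
  omega

end Aux

/-- For every coloured graph `G` on `n` vertices, `c(G) ≤ f(n)`. -/
theorem cherry_count_le (n : ℕ) (G : ColouredGraph (Fin n)) :
    cherryCount G ≤ f n := by
  classical
  have hbdd : BddAbove (Set.range fun G' : ColouredGraph (Fin n) => (trip G').card) :=
    ⟨Fintype.card (Fin n × Fin n × Fin n), by
      rintro _ ⟨G', rfl⟩
      exact Finset.card_le_univ _⟩
  obtain ⟨G₀, h₀⟩ := Nat.sSup_mem (Set.range_nonempty_iff_nonempty.2 ⟨G⟩) hbdd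
  have hmax : ∀ G' : ColouredGraph (Fin n), (trip G').card ≤ (trip G₀).card := by
    intro G'
    have := le_csSup hbdd ⟨G', rfl⟩
    rw [← h₀] at this
    exact this
  have h1 := two_mul_cherry G
  have h2 := main_bound G₀ (extremal G₀ hmax) n Finset.univ (by simp)
  simp only [Finset.mem_univ, and_self, Finset.filter_true] at h2
  have h3 := hmax G
  omega
end

section
/- For every n ≥ 1, f(n) ≤ α·n³, where α = √3/3 − 1/2. -/
theorem step_ineq (k m : ℝ) (hk : 0 ≤ k) (hm : 0 ≤ m) :
    k * (k - 1) / 2 * m + (Real.sqrt 3 / 3 - 1 / 2) * m ^ 3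
      ≤ (Real.sqrt 3 / 3 - 1 / 2) * (k + m) ^ 3 := by
  have h3 : Real.sqrt 3 ^ 2 = 3 := Real.sq_sqrt (by norm_num)
  have hs : (3 / 2 : ℝ) ≤ Real.sqrt 3 := Real.le_sqrt_of_sq_le (by norm_num)
  generalize Real.sqrt 3 = s at *
  have h1 : 0 ≤ k * ((s / 3 - 1 / 2) * (k - s * m) ^ 2) :=
    mul_nonneg hk (mul_nonneg (by linarith) (sq_nonneg _))
  have h2 : 0 ≤ k * m := mul_nonneg hk hm
  have key : (s / 3 - 1 / 2) * (k + m) ^ 3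
      - (k * (k - 1) / 2 * m + (s / 3 - 1 / 2) * m ^ 3)
      = k * ((s / 3 - 1 / 2) * (k - s * m) ^ 2) + k * m / 2 := by
    linear_combination (2 / 3 * k ^ 2 * m - (s / 3 - 1 / 2) * k * m ^ 2) * h3
  linarith

/-- For every `n ≥ 1`, `f(n) ≤ α·n³` where `α = √3/3 − 1/2`. -/
theorem f_le_alpha_cube (n : ℕ) (hn : 1 ≤ n) :
    (f n : ℝ) ≤ (Real.sqrt 3 / 3 - 1 / 2) * (n : ℝ) ^ 3 := by
  induction n using Nat.strong_induction_on with
  | _ n ih =>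
    match n, hn, ih with
    | 1, _, _ =>
      have hs : (3 / 2 : ℝ) ≤ Real.sqrt 3 := Real.le_sqrt_of_sq_le (by norm_num)
      rw [f]
      norm_num
      linarith
    | n + 2, _, ih =>
      obtain ⟨j, hj, hfj⟩ := Finset.exists_mem_eq_sup (Finset.range (n + 1)) ⟨0, by simp⟩
        (fun j => Nat.choose (j + 1) 2 * (n + 1 - j) + f (n + 1 - j))
      have hj' : j < n + 1 := Finset.mem_range.mp hj
      rw [f, hfj]
      obtain ⟨m, hm⟩ : ∃ m, m = n + 1 - j := ⟨_, rfl⟩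
      have hi := ih m (by omega) (by omega)
      have hn2 : n + 2 = (j + 1) + m := by omega
      have hst := step_ineq ((j + 1 : ℕ) : ℝ) m (Nat.cast_nonneg _) (Nat.cast_nonneg _)
      rw [hn2, ← hm]
      push_cast [Nat.cast_choose_two] at hst ⊢
      linarith
end

section
/- The sequence f(n)/n³ converges to α as n → ∞, where α = √3/3 − 1/2; that is, f(n) = α·n³ + o(n³). -/
theorem f_rec (n : ℕ) : f (n + 2) = (Finset.range (n + 1)).sup fun j =>
      Nat.choose (j + 1) 2 * (n + 1 - j) + f (n + 1 - j) := by
  rw [f]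

/-- The key identity behind the value of `α`. -/
theorem key_identity (s m k : ℝ) (hs : s ^ 2 = 3) :
    (s / 3 - 1 / 2) * (m + k) ^ 3 =
      k ^ 2 * m / 2 + (s / 3 - 1 / 2) * m ^ 3 + (s / 3 - 1 / 2) * k * (s * m - k) ^ 2 := by
  linear_combination (-(s / 3 - 1 / 2) * k * m ^ 2 + 2 / 3 * k ^ 2 * m) * hs

theorem choose_two_real (k : ℕ) : ((k.choose 2 : ℕ) : ℝ) = (k : ℝ) * (k - 1) / 2 :=
  Nat.cast_choose_two ℝ k

theorem f_upper (s : ℝ) (hs : s ^ 2 = 3) (h1 : 3 / 2 ≤ s) (n : ℕ) :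
    (f n : ℝ) ≤ (s / 3 - 1 / 2) * (n : ℝ) ^ 3 := by
  have ha : 0 ≤ s / 3 - 1 / 2 := by linarith
  induction n using Nat.strong_induction_on with
  | _ n ih =>
    match n, ih with
    | 0, _ => simp [f]
    | 1, _ => simp [f]; linarith
    | n + 2, ih =>
      obtain ⟨j, hj, he⟩ := Finset.exists_mem_eq_sup (Finset.range (n + 1)) ⟨0, by simp⟩
        (fun j => Nat.choose (j + 1) 2 * (n + 1 - j) + f (n + 1 - j))
      rw [f_rec, he]
      have hj' : j < n + 1 := by simpa using hj
      obtain ⟨m, hm⟩ : ∃ m, m = n + 1 - j := ⟨_, rfl⟩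
      have hn : n + 2 = m + (j + 1) := by omega
      have h := ih m (by omega)
      simp only [← hm]
      rw [hn]
      push_cast
      rw [choose_two_real, key_identity s m (j + 1) hs]
      push_cast
      have hm0 : (0 : ℝ) ≤ m := Nat.cast_nonneg m
      have hj0 : (0 : ℝ) ≤ (j : ℝ) + 1 := by positivity
      have hp : 0 ≤ (s / 3 - 1 / 2) * ((j : ℝ) + 1) * (s * m - (j + 1)) ^ 2 := by positivity
      nlinarith [mul_nonneg hj0 hm0]

theorem f_lower (s : ℝ) (hs : s ^ 2 = 3) (h1 : 3 / 2 ≤ s) (h2 : s ≤ 7 / 4) (n : ℕ) :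
    (s / 3 - 1 / 2) * (n : ℝ) ^ 3 - (n : ℝ) ^ 2 ≤ f n := by
  have ha : 0 ≤ s / 3 - 1 / 2 := by linarith
  have ha' : s / 3 - 1 / 2 ≤ 1 / 12 := by linarith
  induction n using Nat.strong_induction_on with
  | _ n ih =>
    by_cases hn : n < 3
    · have : (0 : ℝ) ≤ f n := Nat.cast_nonneg _
      interval_cases n <;> norm_num <;> linarith
    · obtain ⟨N, rfl⟩ : ∃ N, n = N + 2 := ⟨n - 2, by omega⟩
      have hnR : (3 : ℝ) ≤ ((N + 2 : ℕ) : ℝ) := by exact_mod_cast (by omega : 3 ≤ N + 2)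
      have hs1 : 0 < s + 1 := by linarith
      set m := ⌊((N + 2 : ℕ) : ℝ) / (s + 1)⌋₊ with hmdef
      have hm1 : 1 ≤ m := by
        apply Nat.le_floor
        rw [le_div_iff₀ hs1]
        push_cast at *
        linarith
      have hmle : (m : ℝ) * (s + 1) ≤ ((N + 2 : ℕ) : ℝ) := by
        rw [← le_div_iff₀ hs1]
        exact Nat.floor_le (by positivity)
      have hmlt : ((N + 2 : ℕ) : ℝ) < (m + 1) * (s + 1) := by
        rw [← div_lt_iff₀ hs1]
        exact Nat.lt_floor_add_one _
      have hm0 : (0 : ℝ) ≤ m := Nat.cast_nonneg m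
      have hm2 : (m : ℝ) * 2 ≤ ((N + 2 : ℕ) : ℝ) := by nlinarith
      have hm2' : m * 2 ≤ N + 2 := by exact_mod_cast hm2
      obtain ⟨j, hj⟩ : ∃ j, N + 2 = m + (j + 1) := ⟨N + 1 - m, by omega⟩
      have hle : Nat.choose (j + 1) 2 * m + f m ≤ f (N + 2) := by
        rw [f_rec]
        have := Finset.le_sup (f := fun j => Nat.choose (j + 1) 2 * (N + 1 - j) + f (N + 1 - j))
          (Finset.mem_range.mpr (show j < N + 1 by omega))
        have e : N + 1 - j = m := by omega
        simpa only [e] using this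
      have hleR : (((j + 1).choose 2 : ℕ) : ℝ) * m + f m ≤ f (N + 2) := by exact_mod_cast hle
      have h := ih m (by omega)
      rw [choose_two_real] at hleR
      have hjR : ((N + 2 : ℕ) : ℝ) = m + ((j + 1 : ℕ) : ℝ) := by exact_mod_cast hj
      have hk0 : (0 : ℝ) ≤ ((j + 1 : ℕ) : ℝ) := Nat.cast_nonneg _
      generalize ((j + 1 : ℕ) : ℝ) = k at *
      generalize ((N + 2 : ℕ) : ℝ) = n at *
      generalize (m : ℝ) = m at *
      rw [hjR, key_identity s m k hs]
      have hd : (s * m - k) ^ 2 ≤ 9 := by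
        have h3 : s * m - k ≤ 0 := by nlinarith
        have h4 : -3 ≤ s * m - k := by nlinarith
        nlinarith
      have hl : (s / 3 - 1 / 2) * k * (s * m - k) ^ 2 ≤ 3 / 4 * k := by
        have h5 : (s / 3 - 1 / 2) * k ≤ 1 / 12 * k := by gcongr
        have h6 : (s / 3 - 1 / 2) * k * (s * m - k) ^ 2 ≤ 1 / 12 * k * 9 := by gcongr
        linarith
      have hkm : 0 ≤ k * m := mul_nonneg hk0 hm0
      have hk1 : 3 / 2 ≤ k := by linarith
      nlinarith

theorem f_asymptotics :
    Filter.Tendsto (fun n : ℕ => (f n : ℝ) / (n : ℝ) ^ 3) Filter.atTop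
      (nhds (Real.sqrt 3 / 3 - 1 / 2)) := by
  have hs : Real.sqrt 3 ^ 2 = 3 := Real.sq_sqrt (by norm_num)
  have h1 : 3 / 2 ≤ Real.sqrt 3 := Real.le_sqrt_of_sq_le (by norm_num)
  have h2 : Real.sqrt 3 ≤ 7 / 4 := Real.sqrt_le_iff.mpr (by norm_num)
  have hlim : Filter.Tendsto (fun n : ℕ => (Real.sqrt 3 / 3 - 1 / 2) - 1 / (n : ℝ)) Filter.atTop
      (nhds (Real.sqrt 3 / 3 - 1 / 2)) := by
    simpa using tendsto_const_nhds.sub (tendsto_one_div_atTop_nhds_zero_nat (𝕜 := ℝ))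
  refine tendsto_of_tendsto_of_tendsto_of_le_of_le' hlim tendsto_const_nhds ?_ ?_
  · filter_upwards [Filter.eventually_gt_atTop 0] with n hn
    have hn' : (0 : ℝ) < n := by exact_mod_cast hn
    rw [le_div_iff₀ (by positivity)]
    refine le_trans (le_of_eq ?_) (f_lower _ hs h1 h2 n)
    field_simp
  · filter_upwards [Filter.eventually_gt_atTop 0] with n hn
    have hn' : (0 : ℝ) < n := by exact_mod_cast hn
    rw [div_le_iff₀ (by positivity)]
    exact f_upper _ hs h1 n
end

section
/- For every x ∈ [0,1], g(β) − g(x) ≥ min{0.05·(β−x)², 0.005}, where β = (3−√3)/2 and g(x) = x(1−x)/(2(3−3x+x²)). -/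
/-- `β = (3 − √3)/2`. -/
noncomputable def β : ℝ := (3 - Real.sqrt 3) / 2

/-- `g(x) = x(1 − x) / (2(3 − 3x + x²))`. -/
noncomputable def g (x : ℝ) : ℝ := x * (1 - x) / (2 * (3 - 3 * x + x ^ 2))

/-- For every `x ∈ [0,1]`, `g(β) − g(x) ≥ min{0.05·(β − x)², 0.005}`. -/
theorem g_beta_gap (x : ℝ) (hx0 : 0 ≤ x) (hx1 : x ≤ 1) :
    g β - g x ≥ min (0.05 * (β - x) ^ 2) 0.005 := by
  have hs : Real.sqrt 3 ^ 2 = 3 := Real.sq_sqrt (by norm_num)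
  have hs1 : 1 ≤ Real.sqrt 3 := by
    rw [Real.one_le_sqrt]; norm_num
  have hq : 0 < 3 - 3 * x + x ^ 2 := by nlinarith
  have hq3 : 3 - 3 * x + x ^ 2 ≤ 3 := by nlinarith
  have hb : g β = (Real.sqrt 3 - 3 / 2) / 3 := by
    have h1 : 3 - 3 * β + β ^ 2 = 3 / 2 := by
      unfold β; nlinarith
    have h2 : β * (1 - β) = Real.sqrt 3 - 3 / 2 := by
      unfold β; nlinarith
    unfold g
    rw [h1, h2]; norm_num
  have key : g β - g x
      = (2 * Real.sqrt 3 / 3) * (β - x) ^ 2 / (2 * (3 - 3 * x + x ^ 2)) := by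
    rw [hb, eq_div_iff (by positivity), sub_mul]
    unfold g
    rw [div_mul_cancel₀ _ (by positivity)]
    unfold β
    linear_combination (-(Real.sqrt 3) / 6 + 1 - 2 * x / 3) * hs
  refine le_trans (min_le_left _ _) ?_
  rw [key, le_div_iff₀ (by positivity)]
  nlinarith [mul_le_mul_of_nonneg_left hq3 (sq_nonneg (β - x)),
    mul_le_mul_of_nonneg_left hs1 (sq_nonneg (β - x)), sq_nonneg (β - x)]
end
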